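/- Let A, B ∈ ℝ^{n×n} with A symmetric and B symmetric positive definite, and suppose V ∈ ℝ^{n×n} is invertible with Vᵀ B V = I_n and Vᵀ A V = Λ = diag(λ₁, …, λ_n), where λ_i > 0 for all i. Define B_rkhs = (V Λ Vᵀ)^{-1}. Let λ > 0 and b ∈ ℝ^n, and denote by v_i the i-th column of V. Then A + λ B_rkhs is invertible and (A + λ B_rkhs)^{-1} b = ∑_{i=1}^n (λ_i + λ λ_i^{-1})^{-1} (v_iᵀ b) v_i. -/

import Mathlib

open Matrix

/-- If `V` is invertible, congruence by `V` sends `(V D Vᵀ)⁻¹` to `D⁻¹`. -/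
theorem transpose_mul_inv_mul_of_isUnit {m R : Type*} [Fintype m] [DecidableEq m] [CommRing R]
    {V : Matrix m m R} (hV : IsUnit V) (D : Matrix m m R) :
    Vᵀ * (V * D * Vᵀ)⁻¹ * V = D⁻¹ := by
  have hdet : IsUnit V.det := (isUnit_iff_isUnit_det V).mp hV
  have hdetT : IsUnit Vᵀ.det := by rwa [det_transpose]
  rw [Matrix.mul_inv_rev, Matrix.mul_inv_rev, mul_nonsing_inv_cancel_left _ _ hdetT,
    nonsing_inv_mul_cancel_right _ _ hdet]

/-- A matrix diagonalized by congruence has the inverse `V D⁻¹ Vᵀ`. -/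
theorem mul_mul_diagonal_inv_mul_transpose {m K : Type*} [Fintype m] [DecidableEq m] [Field K]
    {M V : Matrix m m K} {d : m → K} (hd : ∀ i, d i ≠ 0) (h : Vᵀ * M * V = diagonal d) :
    M * (V * diagonal (fun i => (d i)⁻¹) * Vᵀ) = 1 := by
  have hleft : Vᵀ * (M * V * diagonal (fun i => (d i)⁻¹)) = 1 := by
    rw [← Matrix.mul_assoc, ← Matrix.mul_assoc, h, diagonal_mul_diagonal, ← diagonal_one]
    congr 1
    ext i
    exact mul_inv_cancel₀ (hd i)
  simpa only [Matrix.mul_assoc] using mul_eq_one_comm.mp hleft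

/-- Spectral formula for the SIDA-RKHS regularized estimator (Table 1 and Algorithm 1
of the paper): with `B_rkhs = (V Λ Vᵀ)⁻¹` built from the generalized
eigendecomposition `Vᵀ B V = I`, `Vᵀ A V = Λ` with positive eigenvalues, one has
`(A + λ B_rkhs)⁻¹ b = ∑ᵢ (λᵢ + λ λᵢ⁻¹)⁻¹ (vᵢᵀ b) vᵢ`. -/
theorem rkhs_regularized_estimator_spectral_formula
    (n : ℕ) (A B : Matrix (Fin n) (Fin n) ℝ)
    (hA : A.IsSymm) (hB : B.PosDef)
    (V : Matrix (Fin n) (Fin n) ℝ) (lam : Fin n → ℝ)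
    (hV : IsUnit V)
    (hVBV : Vᵀ * B * V = 1)
    (hVAV : Vᵀ * A * V = Matrix.diagonal lam)
    (hlam : ∀ i, 0 < lam i)
    (Brkhs : Matrix (Fin n) (Fin n) ℝ)
    (hBrkhs : Brkhs = (V * Matrix.diagonal lam * Vᵀ)⁻¹)
    (t : ℝ) (ht : 0 < t) (b : Fin n → ℝ) :
    IsUnit (A + t • Brkhs) ∧
    (A + t • Brkhs)⁻¹ *ᵥ b
      = ∑ i, ((lam i + t * (lam i)⁻¹)⁻¹ * ∑ j, V j i * b j) • (fun j => V j i) := by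
  have hd : ∀ i, lam i + t * (lam i)⁻¹ ≠ 0 := fun i =>
    (add_pos (hlam i) (mul_pos ht (inv_pos.mpr (hlam i)))).ne'
  have hinv : (diagonal lam)⁻¹ = diagonal (fun i => (lam i)⁻¹) := by
    apply inv_eq_right_inv
    rw [diagonal_mul_diagonal, ← diagonal_one]
    congr 1
    ext i
    exact mul_inv_cancel₀ (hlam i).ne'
  have hcongr : Vᵀ * (A + t • Brkhs) * V = diagonal (fun i => lam i + t * (lam i)⁻¹) := by
    rw [Matrix.mul_add, Matrix.add_mul, hVAV, Matrix.mul_smul, Matrix.smul_mul, hBrkhs,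
      transpose_mul_inv_mul_of_isUnit hV, hinv, ← diagonal_smul, diagonal_add]
    rfl
  have hright := mul_mul_diagonal_inv_mul_transpose hd hcongr
  refine ⟨IsUnit.of_mul_eq_one _ hright, ?_⟩
  rw [inv_eq_right_inv hright, ← mulVec_mulVec, ← mulVec_mulVec]
  ext k
  rw [mulVec_eq_sum, Finset.sum_apply, Finset.sum_apply]
  refine Finset.sum_congr rfl fun i _ => ?_
  rw [mulVec_diagonal, op_smul_eq_smul]
  rfl
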